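/- Let A(n; c, d) be the number of compositions of n that contain exactly c occurrences of (2,3,4) and exactly d occurrences of (4,3,2). Then in the ring of formal power series over ℚ in the variables x, X, Y, the series F(x,X,Y) = Σ_{n≥0} Σ_{c≥0} Σ_{d≥0} A(n;c,d) xⁿ Xᶜ Yᵈ satisfies F · D = N, where D = −1 + 4x − 5x² + 2x³ − x⁴ + 3x⁵ − 2x⁶ − x⁷ + 2x⁸ − 2x⁹ + 2x¹⁰ − 3x¹¹ + 2x¹² − x¹³ + x¹⁴ − x¹⁶ + x¹⁸ + x⁹X + x⁹Y + 3x¹¹X + 3x¹¹Y − 2x¹⁰X − 2x¹⁰Y − 2x¹²X − 2x¹²Y + x¹³X + x¹³Y − 2x¹⁴X − 2x¹⁴Y + x¹⁴X² + x¹⁴Y² + 2x¹⁶X + 2x¹⁶Y − x¹⁶X² − x¹⁶Y² − 2x¹⁸X − 2x¹⁸Y + x¹⁸X² + x¹⁸Y² + x⁴XY − 3x⁵XY + 2x⁶XY + x⁷XY − 2x⁸XY + 2x¹⁰XY − 3x¹¹XY + 2x¹²XY − x¹³XY + 3x¹⁴XY − x¹⁴X²Y − x¹⁴XY² − 4x¹⁶XY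 + 2x¹⁶X²Y + 2x¹⁶XY² − x¹⁶X²Y² + 4x¹⁸XY − 2x¹⁸X²Y − 2x¹⁸XY² + x¹⁸X²Y², and N = −1 + 3x − 3x² + x³ − x⁴ + 2x⁵ − x⁶ − x⁷ + x⁸ + 2x¹⁰ − 2x¹¹ + x¹² − x¹³ + x¹⁵ − x¹⁷ − x¹²X − x¹²Y + 2x¹¹X + 2x¹¹Y − 2x¹⁰X − 2x¹⁰Y + 2x¹³X + 2x¹³Y − x¹³X² − x¹³Y² − 2x¹⁵X − 2x¹⁵Y + x¹⁵X² + x¹⁵Y² + 2x¹⁷X + 2x¹⁷Y − x¹⁷X² − x¹⁷Y² + x⁴XY − 2x⁵XY + x⁶XY + x⁷XY − x⁸XY + 2x¹⁰XY − 2x¹¹XY + x¹²XY − 3x¹³XY + x¹³X²Y + x¹³XY² + 4x¹⁵XY − 2x¹⁵X²Y − 2x¹⁵XY² + x¹⁵X²Y² − 4x¹⁷XY + 2x¹⁷X²Y + 2x¹⁷XY² − x¹⁷X²Y². -/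

import Mathlib

/-- `Occurs b c i` says that the composition (list) `b = (b_1, …, b_s)` occurs in
`c = (c_1, …, c_k)` at (0-indexed) position `i`: `i + s ≤ k` and `b_j ≤ c_{i+j}`
for all `0 ≤ j < s`. -/
def Occurs (b c : List ℕ) (i : ℕ) : Prop :=
  i + b.length ≤ c.length ∧ ∀ j < b.length, b.getD j 0 ≤ c.getD (i + j) 0

instance (b c : List ℕ) (i : ℕ) : Decidable (Occurs b c i) :=
  inferInstanceAs
    (Decidable (i + b.length ≤ c.length ∧ ∀ j < b.length, b.getD j 0 ≤ c.getD (i + j) 0))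

/-- The composition `c` includes (contains) the composition `b`. -/
def Contains (c b : List ℕ) : Prop := ∃ i, Occurs b c i

/-- The number of occurrences of `b` in `c` (number of positions at which `b` occurs). -/
def numOcc (b c : List ℕ) : ℕ :=
  ((Finset.range (c.length + 1)).filter fun i => Occurs b c i).card

open MvPowerSeries in
/-- The variable `x` of `ℚ[[x, X, Y]]`, marking the size `n`. -/
noncomputable def x : MvPowerSeries (Fin 3) ℚ := MvPowerSeries.X 0

open MvPowerSeries in
/-- The variable `X` of `ℚ[[x, X, Y]]`, marking occurrences of `(2,3,4)`. -/
noncomputable def Xm : MvPowerSeries (Fin 3) ℚ := MvPowerSeries.X 1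

open MvPowerSeries in
/-- The variable `Y` of `ℚ[[x, X, Y]]`, marking occurrences of `(4,3,2)`. -/
noncomputable def Ym : MvPowerSeries (Fin 3) ℚ := MvPowerSeries.X 2

/-- `A n c d` is the number of compositions of `n` containing exactly `c` occurrences
of `(2,3,4)` and exactly `d` occurrences of `(4,3,2)`. -/
noncomputable def A (n c d : ℕ) : ℕ :=
  Nat.card {C : Composition n //
    numOcc [2, 3, 4] C.blocks = c ∧ numOcc [4, 3, 2] C.blocks = d}

/-- The stated polynomial `D` (the denominator of Theorem 3 of the paper). -/
noncomputable def Dpoly : MvPowerSeries (Fin 3) ℚ :=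
  -1 + 4 * x - 5 * x ^ 2 + 2 * x ^ 3 - x ^ 4 + 3 * x ^ 5 - 2 * x ^ 6 - x ^ 7
      + 2 * x ^ 8 - 2 * x ^ 9 + 2 * x ^ 10 - 3 * x ^ 11 + 2 * x ^ 12 - x ^ 13 + x ^ 14
      - x ^ 16 + x ^ 18 + x ^ 9 * Xm + x ^ 9 * Ym + 3 * x ^ 11 * Xm + 3 * x ^ 11 * Ym
      - 2 * x ^ 10 * Xm - 2 * x ^ 10 * Ym - 2 * x ^ 12 * Xm - 2 * x ^ 12 * Ym
      + x ^ 13 * Xm + x ^ 13 * Ym - 2 * x ^ 14 * Xm - 2 * x ^ 14 * Ym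
      + x ^ 14 * Xm ^ 2 + x ^ 14 * Ym ^ 2 + 2 * x ^ 16 * Xm + 2 * x ^ 16 * Ym
      - x ^ 16 * Xm ^ 2 - x ^ 16 * Ym ^ 2 - 2 * x ^ 18 * Xm - 2 * x ^ 18 * Ym
      + x ^ 18 * Xm ^ 2 + x ^ 18 * Ym ^ 2 + x ^ 4 * Xm * Ym - 3 * x ^ 5 * Xm * Ym
      + 2 * x ^ 6 * Xm * Ym + x ^ 7 * Xm * Ym - 2 * x ^ 8 * Xm * Ym
      + 2 * x ^ 10 * Xm * Ym - 3 * x ^ 11 * Xm * Ym + 2 * x ^ 12 * Xm * Ym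
      - x ^ 13 * Xm * Ym + 3 * x ^ 14 * Xm * Ym - x ^ 14 * Xm ^ 2 * Ym
      - x ^ 14 * Xm * Ym ^ 2 - 4 * x ^ 16 * Xm * Ym + 2 * x ^ 16 * Xm ^ 2 * Ym
      + 2 * x ^ 16 * Xm * Ym ^ 2 - x ^ 16 * Xm ^ 2 * Ym ^ 2 + 4 * x ^ 18 * Xm * Ym
      - 2 * x ^ 18 * Xm ^ 2 * Ym - 2 * x ^ 18 * Xm * Ym ^ 2 + x ^ 18 * Xm ^ 2 * Ym ^ 2

/-- The stated polynomial `N` (the numerator of Theorem 3 of the paper). -/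
noncomputable def Npoly : MvPowerSeries (Fin 3) ℚ :=
  -1 + 3 * x - 3 * x ^ 2 + x ^ 3 - x ^ 4 + 2 * x ^ 5 - x ^ 6 - x ^ 7 + x ^ 8
      + 2 * x ^ 10 - 2 * x ^ 11 + x ^ 12 - x ^ 13 + x ^ 15 - x ^ 17 - x ^ 12 * Xm
      - x ^ 12 * Ym + 2 * x ^ 11 * Xm + 2 * x ^ 11 * Ym - 2 * x ^ 10 * Xm
      - 2 * x ^ 10 * Ym + 2 * x ^ 13 * Xm + 2 * x ^ 13 * Ym - x ^ 13 * Xm ^ 2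
      - x ^ 13 * Ym ^ 2 - 2 * x ^ 15 * Xm - 2 * x ^ 15 * Ym + x ^ 15 * Xm ^ 2
      + x ^ 15 * Ym ^ 2 + 2 * x ^ 17 * Xm + 2 * x ^ 17 * Ym - x ^ 17 * Xm ^ 2
      - x ^ 17 * Ym ^ 2 + x ^ 4 * Xm * Ym - 2 * x ^ 5 * Xm * Ym + x ^ 6 * Xm * Ym
      + x ^ 7 * Xm * Ym - x ^ 8 * Xm * Ym + 2 * x ^ 10 * Xm * Ym
      - 2 * x ^ 11 * Xm * Ym + x ^ 12 * Xm * Ym - 3 * x ^ 13 * Xm * Ym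
      + x ^ 13 * Xm ^ 2 * Ym + x ^ 13 * Xm * Ym ^ 2 + 4 * x ^ 15 * Xm * Ym
      - 2 * x ^ 15 * Xm ^ 2 * Ym - 2 * x ^ 15 * Xm * Ym ^ 2 + x ^ 15 * Xm ^ 2 * Ym ^ 2
      - 4 * x ^ 17 * Xm * Ym + 2 * x ^ 17 * Xm ^ 2 * Ym + 2 * x ^ 17 * Xm * Ym ^ 2
      - x ^ 17 * Xm ^ 2 * Ym ^ 2

namespace CompositionGF

open MvPowerSeries

/-- The compositions (of arbitrary size), as lists of positive integers. -/
def compositions : Set (List ℕ) := {l | ∀ a ∈ l, 0 < a}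

/-- The exponent of the monomial that a composition contributes to the generating function. -/
noncomputable def wt (l : List ℕ) : Fin 3 →₀ ℕ :=
  Finsupp.single 0 l.sum + Finsupp.single 1 (numOcc [2, 3, 4] l)
    + Finsupp.single 2 (numOcc [4, 3, 2] l)

/-- The generating function of a set of compositions. -/
noncomputable def gf (S : Set (List ℕ)) : MvPowerSeries (Fin 3) ℚ :=
  fun m => ({l ∈ S | wt l = m}.ncard : ℚ)

lemma coeff_gf (S : Set (List ℕ)) (m : Fin 3 →₀ ℕ) :
    coeff m (gf S) = ({l ∈ S | wt l = m}.ncard : ℚ) := rfl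

lemma wt_eq_iff (l : List ℕ) (m : Fin 3 →₀ ℕ) :
    wt l = m ↔ l.sum = m 0 ∧ numOcc [2, 3, 4] l = m 1 ∧ numOcc [4, 3, 2] l = m 2 := by
  constructor
  · rintro rfl
    simp [wt]
  · rintro ⟨h0, h1, h2⟩
    ext i
    fin_cases i <;> simp [wt, h0, h1, h2]

lemma coeff_gf_compositions (m : Fin 3 →₀ ℕ) :
    coeff m (gf compositions) = A (m 0) (m 1) (m 2) := by
  rw [coeff_gf, A, ← Nat.card_coe_set_eq]
  congr 1
  refine Nat.card_congr
    { toFun := fun l => ⟨⟨l.1, fun h => l.2.1 _ h, ((wt_eq_iff _ _).1 l.2.2).1⟩,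
        ((wt_eq_iff _ _).1 l.2.2).2⟩
      invFun := fun C => ⟨C.1.blocks, fun _ h => C.1.blocks_pos h,
        (wt_eq_iff _ _).2 ⟨C.1.blocks_sum, C.2⟩⟩
      left_inv := fun _ => rfl
      right_inv := fun _ => rfl }

lemma finite_wt_eq {S : Set (List ℕ)} (hS : S ⊆ compositions) (m : Fin 3 →₀ ℕ) :
    {l ∈ S | wt l = m}.Finite := by
  refine (Set.finite_range fun C : Composition (m 0) => C.blocks).subset ?_
  rintro l ⟨hl, hm⟩
  exact ⟨⟨l, fun h => hS hl _ h, ((wt_eq_iff _ _).1 hm).1⟩, rfl⟩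

lemma gf_union {S T : Set (List ℕ)} (hS : S ⊆ compositions) (hT : T ⊆ compositions)
    (h : Disjoint S T) : gf (S ∪ T) = gf S + gf T := by
  ext m
  rw [map_add, coeff_gf, coeff_gf, coeff_gf, ← Nat.cast_add,
    ← Set.ncard_union_eq (h.mono (fun _ h => h.1) (fun _ h => h.1))
      (finite_wt_eq hS m) (finite_wt_eq hT m)]
  congr 2
  ext l
  simp only [Set.mem_union, Set.mem_ofPred_eq]
  tauto

lemma gf_image {S : Set (List ℕ)} {f : List ℕ → List ℕ} (hf : Set.InjOn f S)
    {e : Fin 3 →₀ ℕ} (he : ∀ l ∈ S, wt (f l) = e + wt l) :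
    gf (f '' S) = monomial e 1 * gf S := by
  ext m
  rw [coeff_monomial_mul, one_mul, coeff_gf, coeff_gf]
  split_ifs with h
  · rw [← Set.InjOn.ncard_image (s := {l ∈ S | wt l = m - e}) (hf.mono fun _ h => h.1)]
    congr 2
    ext l
    constructor
    · rintro ⟨⟨k, hk, rfl⟩, hl⟩
      refine ⟨k, ⟨hk, ?_⟩, rfl⟩
      rw [← hl, he k hk, add_tsub_cancel_left]
    · rintro ⟨k, ⟨hk, hm⟩, rfl⟩
      refine ⟨⟨k, hk, rfl⟩, ?_⟩
      rw [he k hk, hm, add_tsub_cancel_of_le h]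
  · rw [Nat.cast_eq_zero]
    convert Set.ncard_empty (List ℕ)
    refine Set.subset_empty_iff.1 ?_
    rintro _ ⟨⟨k, hk, rfl⟩, hl⟩
    exact h (hl ▸ he k hk ▸ le_self_add)

lemma occurs_cons_succ (p q r a : ℕ) (l : List ℕ) (i : ℕ) :
    Occurs [p, q, r] (a :: l) (i + 1) ↔ Occurs [p, q, r] l i := by
  simp only [Occurs, List.length_cons, List.length_nil]
  refine and_congr (by omega) (forall₂_congr fun j _ => ?_)
  rw [show i + 1 + j = (i + j) + 1 by omega, List.getD_cons_succ]

lemma occurs_cons_zero {p q r a : ℕ} {l : List ℕ} (hr : 0 < r) :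
    Occurs [p, q, r] (a :: l) 0 ↔ p ≤ a ∧ q ≤ l.getD 0 0 ∧ r ≤ l.getD 1 0 := by
  rcases l with _ | ⟨b, _ | ⟨c, l⟩⟩
  · simp [Occurs]; omega
  · simp [Occurs]; omega
  · simp only [Occurs, List.length_cons, List.length_nil]
    constructor
    · rintro ⟨-, h⟩
      exact ⟨h 0 (by omega), h 1 (by omega), h 2 (by omega)⟩
    · rintro ⟨h0, h1, h2⟩
      refine ⟨by omega, fun j hj => ?_⟩
      interval_cases j
      · exact h0
      · exact h1
      · exact h2

lemma numOcc_cons (p q a : ℕ) {r : ℕ} (hr : 0 < r) (l : List ℕ) :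
    numOcc [p, q, r] (a :: l) =
      (if p ≤ a ∧ q ≤ l.getD 0 0 ∧ r ≤ l.getD 1 0 then 1 else 0) + numOcc [p, q, r] l := by
  unfold numOcc
  rw [Finset.card_filter, Finset.card_filter, List.length_cons, Finset.sum_range_succ', add_comm]
  simp only [occurs_cons_succ, occurs_cons_zero hr]

/-- The compositions whose first part lies in `B` and whose remaining parts form a member
of `U`. -/
def prepend (B : Set ℕ) (U : Set (List ℕ)) : Set (List ℕ) := Set.image2 List.cons B U

lemma cons_mem_prepend {B : Set ℕ} {U : Set (List ℕ)} {a : ℕ} {l : List ℕ} :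
    a :: l ∈ prepend B U ↔ a ∈ B ∧ l ∈ U := by
  simp [prepend]

lemma nil_notMem_prepend {B : Set ℕ} {U : Set (List ℕ)} : [] ∉ prepend B U := by
  simp [prepend]

lemma prepend_subset {B : Set ℕ} {U : Set (List ℕ)} (hB : ∀ a ∈ B, 0 < a)
    (hU : U ⊆ compositions) : prepend B U ⊆ compositions := by
  rintro _ ⟨a, ha, l, hl, rfl⟩ b hb
  rcases List.mem_cons.1 hb with rfl | hb
  · exact hB _ ha
  · exact hU hl _ hb

lemma disjoint_prepend_right {U V : Set (List ℕ)} (B : Set ℕ) (h : Disjoint U V) :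
    Disjoint (prepend B U) (prepend B V) := by
  rw [Set.disjoint_left]
  rintro _ ⟨a, _, l, hl, rfl⟩ hV
  exact Set.disjoint_left.1 h hl (cons_mem_prepend.1 hV).2

lemma disjoint_prepend_left {B C : Set ℕ} (U V : Set (List ℕ)) (h : Disjoint B C) :
    Disjoint (prepend B U) (prepend C V) := by
  rw [Set.disjoint_left]
  rintro _ ⟨a, ha, l, _, rfl⟩ hV
  exact Set.disjoint_left.1 h ha (cons_mem_prepend.1 hV).1

/-- `q` is the generating function of single parts taken from `B`: prepending a part from `B`
multiplies generating functions by `q`, up to the monomial that accounts for the new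
occurrences of the patterns. -/
def IsPartGF (B : Set ℕ) (q : MvPowerSeries (Fin 3) ℚ) : Prop :=
  ∀ (U : Set (List ℕ)) (e : Fin 3 →₀ ℕ), U ⊆ compositions →
    (∀ a ∈ B, ∀ l ∈ U, wt (a :: l) = (Finsupp.single 0 a + e) + wt l) →
    gf (prepend B U) = q * monomial e 1 * gf U

lemma monomial_single_zero_add (a : ℕ) (e : Fin 3 →₀ ℕ) :
    (monomial (Finsupp.single 0 a + e) 1 : MvPowerSeries (Fin 3) ℚ) = x ^ a * monomial e 1 := by
  rw [x, X_pow_eq, monomial_mul_monomial, one_mul]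

lemma isPartGF_singleton (a : ℕ) : IsPartGF {a} (x ^ a) := by
  intro U e _ he
  rw [prepend, Set.image2_singleton_left, gf_image (List.cons_injective.injOn) (he a rfl),
    monomial_single_zero_add]

/-- Increase the first part of a composition by one. -/
def incHead : List ℕ → List ℕ
  | [] => []
  | a :: l => (a + 1) :: l

lemma incHead_injective : Function.Injective incHead := by
  rintro (_ | ⟨a, l⟩) (_ | ⟨b, k⟩) h <;> simp_all [incHead]

lemma isPartGF_Ici {n : ℕ} (hn : 0 < n) {q : MvPowerSeries (Fin 3) ℚ}
    (hq : (1 - x) * q = x ^ n) : IsPartGF (Set.Ici n) q := by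
  intro U e hU he
  have hsplit : prepend (Set.Ici n) U = prepend {n} U ∪ incHead '' prepend (Set.Ici n) U := by
    ext (_ | ⟨a, l⟩)
    · simp [prepend, incHead]
    · simp only [Set.mem_union, cons_mem_prepend, Set.mem_Ici, Set.mem_singleton_iff,
        Set.mem_image]
      constructor
      · rintro ⟨ha, hl⟩
        rcases ha.eq_or_lt with rfl | ha
        · exact Or.inl ⟨rfl, hl⟩
        · refine Or.inr ⟨(a - 1) :: l, cons_mem_prepend.2 ⟨Nat.le_sub_one_of_lt ha, hl⟩, ?_⟩
          rw [incHead, Nat.sub_add_cancel (by omega)]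
      · rintro (⟨rfl, hl⟩ | ⟨_, ⟨b, hb, k, hk, rfl⟩, h⟩)
        · exact ⟨le_rfl, hl⟩
        · obtain ⟨rfl, rfl⟩ := List.cons.inj h
          exact ⟨Nat.le_succ_of_le hb, hk⟩
  have hsub : prepend (Set.Ici n) U ⊆ compositions :=
    prepend_subset (fun a ha => hn.trans_le ha) hU
  have hdisj : Disjoint (prepend {n} U) (incHead '' prepend (Set.Ici n) U) := by
    rw [Set.disjoint_left]
    rintro _ ⟨a, rfl, l, _, rfl⟩ ⟨_, ⟨b, hb, k, _, rfl⟩, h⟩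
    have := (List.cons.inj h).1
    have hb : a ≤ b := hb
    omega
  have hinc : gf (incHead '' prepend (Set.Ici n) U) = x * gf (prepend (Set.Ici n) U) := by
    rw [gf_image (e := Finsupp.single 0 1) incHead_injective.injOn]
    · rfl
    · rintro _ ⟨a, ha, l, hl, rfl⟩
      rw [incHead, he a ha l hl, he (a + 1) (Nat.le_succ_of_le ha) l hl, Finsupp.single_add]
      abel
  have h := gf_union (hsub.trans' (hsplit ▸ Set.subset_union_left))
    (hsub.trans' (Set.subset_union_right.trans_eq hsplit.symm)) hdisj
  rw [← hsplit, hinc, isPartGF_singleton n U e hU fun a ha l hl => he a (ha ▸ Set.self_mem_Ici) l hl]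
    at h
  have hx : (1 - x : MvPowerSeries (Fin 3) ℚ) ≠ 0 := by
    intro h0
    have := congrArg (coeff 0) h0
    simp [x] at this
  apply mul_left_cancel₀ hx
  linear_combination h - monomial e 1 * gf U * hq

lemma exists_one_sub_mul_eq (p : MvPowerSeries (Fin 3) ℚ) : ∃ q, (1 - x) * q = p := by
  refine ⟨(1 - x)⁻¹ * p, ?_⟩
  rw [← mul_assoc, MvPowerSeries.mul_inv_cancel _ (by simp [x]), one_mul]

/-- The four classes of parts that the patterns `(2,3,4)` and `(4,3,2)` can distinguish. -/
def partClass : Fin 4 → Set ℕ := ![{1}, {2}, {3}, Set.Ici 4]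

lemma partClass_pos {i : Fin 4} {a : ℕ} (h : a ∈ partClass i) : 0 < a := by
  fin_cases i <;> simp [partClass] at h <;> omega

lemma le_iff_of_mem_partClass {i : Fin 4} {a : ℕ} (h : a ∈ partClass i) (j : Fin 4) :
    (j : ℕ) + 1 ≤ a ↔ j ≤ i := by
  fin_cases i <;> simp [partClass] at h <;> fin_cases j <;> simp <;> omega

lemma disjoint_partClass {i j : Fin 4} (h : i ≠ j) : Disjoint (partClass i) (partClass j) := by
  rw [Set.disjoint_left]
  intro a hi hj
  exact h (le_antisymm ((le_iff_of_mem_partClass hj i).1 ((le_iff_of_mem_partClass hi i).2 le_rfl))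
    ((le_iff_of_mem_partClass hi j).1 ((le_iff_of_mem_partClass hj j).2 le_rfl)))

lemma exists_mem_partClass {a : ℕ} (h : 0 < a) : ∃ i, a ∈ partClass i := by
  by_cases h4 : 4 ≤ a
  · exact ⟨3, h4⟩
  · interval_cases a
    · exact ⟨0, rfl⟩
    · exact ⟨1, rfl⟩
    · exact ⟨2, rfl⟩

/-- The compositions whose first part is in class `i`. -/
def startsWith (i : Fin 4) : Set (List ℕ) := prepend (partClass i) compositions

lemma startsWith_subset (i : Fin 4) : startsWith i ⊆ compositions :=
  prepend_subset (fun _ => partClass_pos) subset_rfl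

lemma compositions_eq :
    compositions = {[]} ∪ (startsWith 0 ∪ (startsWith 1 ∪ (startsWith 2 ∪ startsWith 3))) := by
  apply Set.Subset.antisymm
  · rintro (_ | ⟨a, l⟩) h
    · exact Or.inl rfl
    · obtain ⟨i, hi⟩ := exists_mem_partClass (h a List.mem_cons_self)
      have hl : a :: l ∈ startsWith i :=
        cons_mem_prepend.2 ⟨hi, fun b hb => h b (List.mem_cons_of_mem _ hb)⟩
      fin_cases i <;> simp_all
  · have hnil : ({[]} : Set (List ℕ)) ⊆ compositions := by
      rintro _ rfl
      simp [compositions]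
    simp only [Set.union_subset_iff, startsWith_subset, hnil, and_self]

lemma gf_prepend_compositions {g : Set (List ℕ) → Set (List ℕ)}
    (hunion : ∀ U V, g (U ∪ V) = g U ∪ g V)
    (hdisj : ∀ U V, Disjoint U V → Disjoint (g U) (g V))
    (hsub : ∀ U, U ⊆ compositions → g U ⊆ compositions) :
    gf (g compositions) = gf (g {[]}) + ∑ i, gf (g (startsWith i)) := by
  have hs := fun i => hsub _ (startsWith_subset i)
  have hd : ∀ i j, i ≠ j → Disjoint (g (startsWith i)) (g (startsWith j)) := fun i j h =>
    hdisj _ _ (disjoint_prepend_left _ _ (disjoint_partClass h))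
  have hn : ∀ i, Disjoint (g {[]}) (g (startsWith i)) := fun i =>
    hdisj _ _ (Set.disjoint_singleton_left.2 nil_notMem_prepend)
  have hnil : g {[]} ⊆ compositions := hsub _ (by rintro _ rfl; simp [compositions])
  conv_lhs => rw [compositions_eq]
  simp only [hunion]
  rw [gf_union hnil, gf_union (hs 0), gf_union (hs 1), gf_union (hs 2) (hs 3) (hd _ _ (by decide)),
    Fin.sum_univ_four]
  · ring
  all_goals simp only [Set.union_subset_iff, Set.disjoint_union_right, hs, hn, and_self]
  all_goals simp [hd]

lemma gf_nil : gf {[]} = 1 := by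
  ext m
  rw [coeff_gf, coeff_one]
  have h : wt [] = 0 := by simp [wt, numOcc, Occurs]
  split_ifs with hm
  · subst hm
    rw [show {l ∈ ({[]} : Set (List ℕ)) | wt l = 0} = {[]} by ext l; simp; rintro rfl; exact h]
    simp
  · rw [Nat.cast_eq_zero]
    convert Set.ncard_empty (List ℕ)
    refine Set.subset_empty_iff.1 ?_
    rintro _ ⟨rfl, hl⟩
    exact hm (hl ▸ h)

/-- The exponent recording the new occurrences created by putting a part of class `i` in front of
a composition that starts with parts of classes `j` and `k`. -/
noncomputable def newOcc (i j k : Fin 4) : Fin 3 →₀ ℕ :=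
  Finsupp.single 1 (if 1 ≤ i ∧ 2 ≤ j ∧ 3 ≤ k then 1 else 0)
    + Finsupp.single 2 (if 3 ≤ i ∧ 2 ≤ j ∧ 1 ≤ k then 1 else 0)

lemma wt_cons (a : ℕ) (l : List ℕ) :
    wt (a :: l) = (Finsupp.single 0 a +
      (Finsupp.single 1 (if 2 ≤ a ∧ 3 ≤ l.getD 0 0 ∧ 4 ≤ l.getD 1 0 then 1 else 0)
        + Finsupp.single 2 (if 4 ≤ a ∧ 3 ≤ l.getD 0 0 ∧ 2 ≤ l.getD 1 0 then 1 else 0))) + wt l := by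
  simp only [wt, List.sum_cons, numOcc_cons _ _ _ (show 0 < 4 by decide),
    numOcc_cons _ _ _ (show 0 < 2 by decide), Finsupp.single_add]
  abel

/-- The generating function of the compositions whose first two parts are in classes `i`, `j`. -/
noncomputable def gfPair (i j : Fin 4) : MvPowerSeries (Fin 3) ℚ :=
  gf (prepend (partClass i) (startsWith j))

lemma gf_compositions : gf compositions = 1 + ∑ i, gf (startsWith i) := by
  have h := gf_prepend_compositions (g := id) (fun _ _ => rfl) (fun _ _ h => h) (fun _ h => h)
  rwa [id, id, gf_nil] at h

lemma gf_prepend_nil {i : Fin 4} {p : MvPowerSeries (Fin 3) ℚ} (hp : IsPartGF (partClass i) p) :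
    gf (prepend (partClass i) {[]}) = p := by
  rw [hp {[]} 0 (by rintro _ rfl; simp [compositions]), gf_nil]
  · simp
  · rintro a _ _ rfl
    simp [wt_cons]

lemma gf_startsWith {i : Fin 4} {p : MvPowerSeries (Fin 3) ℚ} (hp : IsPartGF (partClass i) p) :
    gf (startsWith i) = p + ∑ j, gfPair i j := by
  rw [startsWith, gf_prepend_compositions (g := prepend (partClass i))
    (fun _ _ => Set.image2_union_right) (fun _ _ => disjoint_prepend_right _)
    (fun _ => prepend_subset fun _ => partClass_pos),
    gf_prepend_nil hp]
  rfl

lemma gfPair_eq {q : Fin 4 → MvPowerSeries (Fin 3) ℚ} (hq : ∀ i, IsPartGF (partClass i) (q i))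
    (i j : Fin 4) :
    gfPair i j = q i * (q j + ∑ k, monomial (newOcc i j k) 1 * gfPair j k) := by
  have hsub : ∀ {k U}, U ⊆ compositions → prepend (partClass k) U ⊆ compositions :=
    prepend_subset fun _ => partClass_pos
  have hterm : ∀ k, gf (prepend (partClass i) (prepend (partClass j) (startsWith k))) =
      q i * (monomial (newOcc i j k) 1 * gfPair j k) := by
    intro k
    rw [hq i _ (newOcc i j k) (hsub (startsWith_subset k)), mul_assoc, gfPair]
    rintro a ha _ ⟨b, hb, _, ⟨c, hc, l, _, rfl⟩, rfl⟩
    have h1 := (le_iff_of_mem_partClass ha 1).symm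
    have h2 := (le_iff_of_mem_partClass ha 3).symm
    have h3 := (le_iff_of_mem_partClass hb 2).symm
    have h4 := (le_iff_of_mem_partClass hc 1).symm
    have h5 := (le_iff_of_mem_partClass hc 3).symm
    rw [wt_cons, newOcc]
    simp only [h1, h2, h3, h4, h5]
    rfl
  have hnil : gf (prepend (partClass i) (prepend (partClass j) {[]})) = q i * q j := by
    rw [hq i _ 0 (hsub (by rintro _ rfl; simp [compositions])), gf_prepend_nil (hq j)]
    · simp
    · rintro a _ _ ⟨b, _, _, rfl, rfl⟩
      simp [wt_cons]
  rw [gfPair, startsWith, gf_prepend_compositions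
    (g := fun U => prepend (partClass i) (prepend (partClass j) U))
    (fun U V => by simp only [prepend, Set.image2_union_right])
    (fun _ _ h => disjoint_prepend_right _ (disjoint_prepend_right _ h))
    (fun _ h => hsub (hsub h)), hnil, mul_add, Finset.mul_sum]
  simp only [hterm]

lemma monomial_newOcc (i j k : Fin 4) :
    (monomial (newOcc i j k) 1 : MvPowerSeries (Fin 3) ℚ) =
      (if 1 ≤ i ∧ 2 ≤ j ∧ 3 ≤ k then Xm else 1) * (if 3 ≤ i ∧ 2 ≤ j ∧ 1 ≤ k then Ym else 1) := by
  rw [newOcc, ← one_mul (1 : ℚ), ← monomial_mul_monomial]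
  split_ifs <;> simp [Xm, Ym, X, monomial_zero_one]

/-- Elimination of the auxiliary series from the linear system for the generating function. -/
lemma mul_Dpoly_eq {F T₀ T₁ T₂ T₃ q : MvPowerSeries (Fin 3) ℚ}
    {S : Fin 4 → Fin 4 → MvPowerSeries (Fin 3) ℚ} (hq : (1 - x) * q = x ^ 4)
    (hF : F = 1 + (T₀ + T₁ + T₂ + T₃))
    (hT₀ : T₀ = x * F)
    (hT₁ : T₁ = x ^ 2 * (1 + T₀ + T₁) + S 1 2 + S 1 3)
    (hT₂ : T₂ = x * T₁)
    (hT₃ : T₃ = q * (1 + T₀ + T₁) + S 3 2 + S 3 3)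
    (h12 : S 1 2 = x ^ 2 * (T₂ + (Xm - 1) * S 2 3))
    (h13 : S 1 3 = x ^ 2 * (T₃ + (Xm - 1) * S 3 3))
    (h22 : S 2 2 = x * S 1 2)
    (h23 : S 2 3 = x * S 1 3)
    (h32 : S 3 2 = q * (T₂ + (Ym - 1) * (x ^ 3 * T₁ + S 2 2) + (Xm * Ym - 1) * S 2 3))
    (h33 : S 3 3 = q * (T₃ + (Ym - 1) * (q * T₁ + S 3 2) + (Xm * Ym - 1) * S 3 3)) :
    F * Dpoly = Npoly := by
  have ht : T₃ = (1 - x) * F - 1 - (1 + x) * T₁ := by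
    linear_combination -hF - hT₀ - hT₂
  rw [h12, h13] at hT₁
  rw [h22, h23, h12] at h32
  rw [h23, h13] at h32 hT₁
  rw [hT₂] at hT₁ h32
  rw [hT₀] at hT₁ hT₃
  have hz : S 3 2 = T₃ - q * (1 + x * F + T₁) - S 3 3 := by linear_combination -hT₃
  rw [hz] at h32 h33
  rw [ht] at h32 h33 hT₁
  generalize S 3 3 = s at *
  generalize T₁ = y at *
  have e₂ : (1 - x) ^ 2 * s = x ^ 4 * ((1 - x) * ((1 - x) * F - 1 - (1 + x) * y)
      + (Ym - 1) * (x ^ 4 * y + (1 - x) * ((1 - x) * F - 1 - (1 + x) * y)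
        - x ^ 4 * (1 + x * F + y) - (1 - x) * s) + (Xm * Ym - 1) * (1 - x) * s) := by
    linear_combination (1 - x) ^ 2 * h33
      + ((1 - x) * (((1 - x) * F - 1 - (1 + x) * y)
          + (Ym - 1) * (((1 - x) * F - 1 - (1 + x) * y) - s) + (Xm * Ym - 1) * s)
        + (Ym - 1) * (y - (1 + x * F + y)) * ((1 - x) * q + x ^ 4)) * hq
  have e₃ : (1 - x) * ((1 - x) * F - 1 - (1 + x) * y) - x ^ 4 * (1 + x * F + y) - (1 - x) * s
      = x ^ 4 * (x * y + (Ym - 1) * (x ^ 3 * y + x ^ 4 * y + (Xm - 1) * x ^ 6 *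
        (((1 - x) * F - 1 - (1 + x) * y) + (Xm - 1) * s))
        + (Xm * Ym - 1) * x ^ 3 * (((1 - x) * F - 1 - (1 + x) * y) + (Xm - 1) * s)) := by
    linear_combination (1 - x) * h32 + ((1 + x * F + y)
      + (x * y + (Ym - 1) * (x ^ 3 * y + x ^ 4 * y + (Xm - 1) * x ^ 6 *
        (((1 - x) * F - 1 - (1 + x) * y) + (Xm - 1) * s))
        + (Xm * Ym - 1) * x ^ 3 * (((1 - x) * F - 1 - (1 + x) * y) + (Xm - 1) * s))) * hq
  -- The multipliers are the cofactors of the column of `F` in the system `hT₁`, `e₂`, `e₃`.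
  let a₁ := 1 + (1 + x) * (Xm - 1) * x ^ 5
  let b₁ := -x ^ 2 * (Xm - 1) * (1 + (Xm - 1) * x ^ 3)
  let a₂ := x ^ 4 * (1 - x) * (1 + x) * Ym
  let b₂ := (1 - x) * (1 - x + x ^ 4 * Ym * (1 - Xm))
  let v := (Ym - 1) * (Xm - 1) * x ^ 6 + (Xm * Ym - 1) * x ^ 3
  let a₃ := -(1 - x) * (1 + x) - x ^ 4 - x ^ 5 - x ^ 7 * (Ym - 1) * (1 + x) + x ^ 4 * (1 + x) * v
  let b₃ := -(1 - x) - x ^ 4 * (Xm - 1) * v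
  rw [Dpoly, Npoly]
  linear_combination -(a₂ * b₃ - b₂ * a₃) * hT₁ + (a₁ * b₃ - b₁ * a₃) * e₂
    - (a₁ * b₂ - b₁ * a₂) * e₃

theorem gf_compositions_mul_Dpoly : gf compositions * Dpoly = Npoly := by
  obtain ⟨p, hp⟩ := exists_one_sub_mul_eq (x ^ 4)
  have hq : ∀ i, IsPartGF (partClass i) ((![x, x ^ 2, x ^ 3, p] : Fin 4 → _) i) := by
    intro i
    fin_cases i
    · exact pow_one x ▸ isPartGF_singleton 1
    · exact isPartGF_singleton 2
    · exact isPartGF_singleton 3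
    · exact isPartGF_Ici (by decide) hp
  have hT := fun i => gf_startsWith (hq i)
  have hS := gfPair_eq hq
  simp only [Fin.sum_univ_four, monomial_newOcc] at hT hS
  have hF := gf_compositions
  rw [Fin.sum_univ_four] at hF
  have hT0 := hT 0
  have hT1 := hT 1
  have hT2 := hT 2
  have hT3 := hT 3
  have h00 := hS 0 0
  have h01 := hS 0 1
  have h02 := hS 0 2
  have h03 := hS 0 3
  have h10 := hS 1 0
  have h11 := hS 1 1
  have h12 := hS 1 2
  have h13 := hS 1 3
  have h20 := hS 2 0
  have h21 := hS 2 1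
  have h22 := hS 2 2
  have h23 := hS 2 3
  have h30 := hS 3 0
  have h31 := hS 3 1
  have h32 := hS 3 2
  have h33 := hS 3 3
  clear hS hT hq
  simp [Fin.le_def] at *
  apply mul_Dpoly_eq (S := gfPair) hp hF
  · linear_combination hT0 + h00 + h01 + h02 + h03 - x * (hF + hT0 + hT1 + hT2 + hT3)
  · linear_combination hT1 + h10 + h11 - x ^ 2 * (hT0 + hT1)
  · linear_combination hT2 + h20 + h21 + h22 + h23 - x * (hT1 + h10 + h11 + h12 + h13)
  · linear_combination hT3 + h30 + h31 - p * (hT0 + hT1)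
  · linear_combination h12 - x ^ 2 * hT2
  · linear_combination h13 - x ^ 2 * hT3
  · linear_combination h22 - x * h12
  · linear_combination h23 - x * h13
  · linear_combination h32 - p * hT2 + p * (Ym - 1) * (h21 - x ^ 3 * hT1)
  · linear_combination h33 - p * hT3 + p * (Ym - 1) * (h31 - p * hT1)

end CompositionGF

/-- Theorem 3 of the paper: the trivariate generating function
`F(x,X,Y) = ∑ A(n;c,d) xⁿ Xᶜ Yᵈ` satisfies `F ⬝ D = N` in `ℚ[[x, X, Y]]`, where a
monomial `xⁿ Xᶜ Yᵈ` corresponds to the finitely supported function `m : Fin 3 →₀ ℕ`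
with `m 0 = n`, `m 1 = c`, `m 2 = d`. -/
theorem gf_occurrences_234_432 (F : MvPowerSeries (Fin 3) ℚ)
    (hF : ∀ m : Fin 3 →₀ ℕ, MvPowerSeries.coeff m F = A (m 0) (m 1) (m 2)) :
    F * Dpoly = Npoly := by
  rw [← CompositionGF.gf_compositions_mul_Dpoly]
  congr 1
  ext m
  rw [hF, CompositionGF.coeff_gf_compositions]
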